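/- Let T > 0 and let λ₁, λ₂ be measurable intensity functions on [0,T] satisfying assumption A1 (δ ≤ λᵢ(t) ≤ C for all t ∈ [0,T], i = 1,2, for some constants 0 < δ ≤ C). Define τᵢ = ∫₀ᵀ λᵢ(u) du, pᵢ(t) = λᵢ(t)/τᵢ, and the threshold α_T = τ₁ − τ₂ + log(τ₂/τ₁)·∫₀ᵀ λ₁(t) dt + ∫₀ᵀ log(p₂(t)/p₁(t)) λ₁(t) dt. Then −(τ₁ − τ₂)²/τ₂ − τ₁·K_T(p₁‖p₂) ≤ α_T ≤ −τ₁·K_T(p₁‖p₂), where K_T(p‖q) = ∫₀ᵀ log(p(t)/q(t)) p(t) dt is the Kullback–Leibler divergence between densities p and q on [0,T]. (Lemma 1(a): the case where the observed process has intensity λ₁.) -/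

import Mathlib

open MeasureTheory

theorem pos_aux (T δ C : ℝ) (hT : 0 < T) (hδ : 0 < δ) (l : ℝ → ℝ) (hm : Measurable l)
    (h : ∀ t ∈ Set.Icc (0:ℝ) T, δ ≤ l t ∧ l t ≤ C) : 0 < ∫ u in (0:ℝ)..T, l u := by
  have hi : IntervalIntegrable l volume 0 T := by
    rw [intervalIntegrable_iff_integrableOn_Icc_of_le hT.le]
    refine Measure.integrableOn_of_bounded (M := C) (by simp) hm.aestronglyMeasurable ?_
    refine (ae_restrict_mem measurableSet_Icc).mono fun t ht => ?_
    have := h t ht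
    rw [Real.norm_eq_abs, abs_le]
    constructor <;> linarith
  exact intervalIntegral.intervalIntegral_pos_of_pos_on hi
    (fun t ht => hδ.trans_le (h t ⟨ht.1.le, ht.2.le⟩).1) hT

/-- Lemma 1(a): bounds on the Bayes threshold `α_T` when the observed process has
intensity `λ₁`. -/
theorem bayes_threshold_bounds_class_one
    (T δ C : ℝ) (hT : 0 < T) (hδ : 0 < δ) (hδC : δ ≤ C)
    (l1 l2 : ℝ → ℝ) (hm1 : Measurable l1) (hm2 : Measurable l2)
    (hA1 : ∀ t ∈ Set.Icc (0:ℝ) T, (δ ≤ l1 t ∧ l1 t ≤ C) ∧ (δ ≤ l2 t ∧ l2 t ≤ C))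
    (τ1 τ2 : ℝ) (hτ1 : τ1 = ∫ u in (0:ℝ)..T, l1 u) (hτ2 : τ2 = ∫ u in (0:ℝ)..T, l2 u)
    (p1 p2 : ℝ → ℝ) (hp1 : ∀ t, p1 t = l1 t / τ1) (hp2 : ∀ t, p2 t = l2 t / τ2)
    (K : ℝ) (hK : K = ∫ t in (0:ℝ)..T, Real.log (p1 t / p2 t) * p1 t)
    (α : ℝ)
    (hα : α = τ1 - τ2 + Real.log (τ2 / τ1) * (∫ t in (0:ℝ)..T, l1 t)
        + ∫ t in (0:ℝ)..T, Real.log (p2 t / p1 t) * l1 t) :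
    -((τ1 - τ2) ^ 2 / τ2) - τ1 * K ≤ α ∧ α ≤ -(τ1 * K) := by
  have h1 : 0 < τ1 := hτ1 ▸ pos_aux T δ C hT hδ l1 hm1 fun t ht => (hA1 t ht).1
  have h2 : 0 < τ2 := hτ2 ▸ pos_aux T δ C hT hδ l2 hm2 fun t ht => (hA1 t ht).2
  have hI : (∫ t in (0:ℝ)..T, Real.log (p2 t / p1 t) * l1 t) = -(τ1 * K) := by
    rw [hK, ← intervalIntegral.integral_const_mul, ← intervalIntegral.integral_neg]
    congr 1
    funext t
    have e : l1 t = τ1 * p1 t := by rw [hp1]; field_simp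
    rw [e, ← inv_div (p1 t) (p2 t), Real.log_inv]
    ring
  rw [hI, ← hτ1] at hα
  have hx : 0 < τ2 / τ1 := div_pos h2 h1
  have hu := mul_le_mul_of_nonneg_right (Real.log_le_sub_one_of_pos hx) h1.le
  have hl := mul_le_mul_of_nonneg_right (Real.one_sub_inv_le_log_of_pos hx) h1.le
  have e1 : (τ2 / τ1 - 1) * τ1 = τ2 - τ1 := by field_simp
  have e2 : (1 - (τ2 / τ1)⁻¹) * τ1 = -((τ1 - τ2) ^ 2 / τ2) - (τ1 - τ2) := by
    field_simp
    ring
  rw [e1] at hu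
  rw [e2] at hl
  constructor <;> linarith
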